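/- Let U ⊆ ℝⁿ be open and simply connected, η a symmetric invertible n×n real matrix with inverse entries η^{αβ}, and F: U → ℝ a C⁴ function satisfying the WDVV equations. Let z₁, z₂ ∈ ℝ and let f, g: U → ℝ be C³ functions satisfying the deformed flatness systems ∂²f/∂u^α∂u^β = z₁ c^γ_{αβ} ∂f/∂u^γ and ∂²g/∂u^α∂u^β = z₂ c^γ_{αβ} ∂g/∂u^γ on U. Then: (i) the 1-form T = T_δ du^δ with T_δ := ∂_α f · η^{αμ} c_{μδν} η^{νβ} · ∂_β g is closed on U, i.e. ∂_ε T_δ = ∂_δ T_ε for all δ, ε; and (ii) for every smooth loop u: ℝ/ℤ → U, ∫₀¹ ∂_α f(u(x)) η^{αβ} (d/dx)[ ∂_β g(u(x)) ] dx = 0; that is, the local functionals ∫ f dx and ∫ g dx Poisson-commute with respect to the hydrodynamic bracket {u^α(x), u^β(y)} = η^{αβ} δ′(x−y). -/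

import Mathlib

/-- Partial derivative of a scalar function on `ℝⁿ` in the `i`-th coordinate direction. -/
noncomputable def pd {n : ℕ} (i : Fin n) (f : (Fin n → ℝ) → ℝ) : (Fin n → ℝ) → ℝ :=
  fun x => fderiv ℝ f x (Pi.single i 1)

section Poincare

open Topology Filter

/-- The total space of local primitives of a two-point function `P : X → X → G`: a point
`⟨x, c⟩` stands for the germ at `x` of the function `y ↦ c + P x y`. -/
structure LocalPrimitive {X G : Type*} (P : X → X → G) where
  /-- The point at which the germ is taken. -/
  base : X
  /-- The value of the germ at its base point. -/
  value : G

namespace LocalPrimitive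

variable {X G : Type*} [TopologicalSpace X] [AddCommGroup G] {P : X → X → G}

instance : TopologicalSpace (LocalPrimitive P) where
  IsOpen W := ∀ p ∈ W, ∀ᶠ y in 𝓝 p.base, (⟨y, p.value + P p.base y⟩ : LocalPrimitive P) ∈ W
  isOpen_univ := by simp
  isOpen_inter s t hs ht p hp := (hs p hp.1).and (ht p hp.2)
  isOpen_sUnion S hS p := by
    rintro ⟨s, hs, hp⟩
    exact (hS s hs p hp).mono fun y hy => ⟨s, hs, hy⟩

theorem isOpen_iff {W : Set (LocalPrimitive P)} : IsOpen W ↔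
    ∀ p ∈ W, ∀ᶠ y in 𝓝 p.base, (⟨y, p.value + P p.base y⟩ : LocalPrimitive P) ∈ W :=
  Iff.rfl

theorem continuous_base : Continuous (base : LocalPrimitive P → X) :=
  continuous_def.2 fun _ hV _ hp => hV.mem_nhds hp

theorem isOpen_sheet {x : X} {V : Set X} (hV : IsOpen V)
    (hP : ∀ y ∈ V, ∀ z ∈ V, P x y + P y z = P x z) (c : G) :
    IsOpen {p : LocalPrimitive P | p.base ∈ V ∧ p.value = c + P x p.base} := by
  rintro ⟨y, v⟩ ⟨hy, hv⟩
  filter_upwards [hV.mem_nhds hy] with z hz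
  refine ⟨hz, ?_⟩
  dsimp only at hv ⊢
  rw [hv, add_assoc, hP y hy z hz]

theorem continuous_sheet {x : X} {V : Set X} (hV : IsOpen V)
    (hP : ∀ y ∈ V, ∀ z ∈ V, P x y + P y z = P x z) (c : G) :
    Continuous fun y : V => (⟨y, c + P x y⟩ : LocalPrimitive P) := by
  refine continuous_def.2 fun W hW => isOpen_iff_mem_nhds.2 fun y hy => ?_
  have h := hV.mem_nhds y.2
  have hW' := hW _ hy
  rw [mem_nhds_subtype_iff_nhdsWithin, hV.nhdsWithin_eq y.2]
  filter_upwards [h, hW'] with z hz hzW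
  refine ⟨⟨z, hz⟩, ?_, rfl⟩
  simpa only [Set.mem_preimage, add_assoc, hP y y.2 z hz] using hzW

theorem isCoveringMap_base
    (hP : ∀ x, ∃ V, IsOpen V ∧ x ∈ V ∧ ∀ y ∈ V, ∀ z ∈ V, P x y + P y z = P x z) :
    IsCoveringMap (base : LocalPrimitive P → X) := by
  intro x
  obtain ⟨V, hV, hxV, hPV⟩ := hP x
  have hxx : P x x = 0 := by simpa using hPV x hxV x hxV
  have hdisc : DiscreteTopology (base ⁻¹' {x} : Set (LocalPrimitive P)) := by
    refine discreteTopology_iff_isOpen_singleton.2 fun e => ?_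
    refine ⟨_, isOpen_sheet hV hPV e.1.value, ?_⟩
    ext ⟨⟨y, v⟩, hy⟩
    obtain ⟨⟨y', v'⟩, hy'⟩ := e
    obtain rfl : y = x := hy
    obtain rfl : y' = y := hy'
    simp [hxx, hxV, Subtype.ext_iff]
  refine ⟨hdisc, V, hxV, hV, hV.preimage continuous_base,
    { toFun e := (⟨e.1.base, e.2⟩, ⟨⟨x, e.1.value - P x e.1.base⟩, rfl⟩)
      invFun q := ⟨⟨q.1, q.2.1.value + P x q.1⟩, q.1.2⟩
      left_inv e := by simp
      right_inv q := by
        obtain ⟨y, ⟨⟨x', v⟩, hx'⟩⟩ := q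
        obtain rfl : x' = x := hx'
        simp
      continuous_toFun := ?_
      continuous_invFun := ?_ }, fun e => rfl⟩
  · refine .prodMk ((continuous_base.comp continuous_subtype_val).subtype_mk _) ?_
    refine continuous_discrete_rng.2 fun e => ?_
    refine ⟨_, isOpen_sheet hV hPV e.1.value, ?_⟩
    ext ⟨⟨y, v⟩, hy⟩
    obtain ⟨⟨x', v'⟩, hx'⟩ := e
    obtain rfl : x' = x := hx'
    have hy : y ∈ V := hy
    simp [hy, sub_eq_iff_eq_add, Subtype.ext_iff]
  · refine continuous_prod_of_discrete_right.2 fun e => ?_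
    exact (continuous_sheet hV hPV e.1.value).subtype_mk _

end LocalPrimitive

/-- On a simply connected space, a two-point function that is locally a cocycle is locally the
difference of a globally defined function. -/
theorem exists_eventually_eq_add_of_simplyConnectedSpace {X G : Type*} [TopologicalSpace X]
    [SimplyConnectedSpace X] [LocallyPathConnectedSpace X] [AddCommGroup G] {P : X → X → G}
    (hP : ∀ x, ∃ V, IsOpen V ∧ x ∈ V ∧ ∀ y ∈ V, ∀ z ∈ V, P x y + P y z = P x z) :
    ∃ φ : X → G, ∀ x, ∀ᶠ y in 𝓝 x, φ y = φ x + P x y := by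
  obtain ⟨x₀⟩ : Nonempty X := inferInstance
  obtain ⟨s, ⟨-, hs⟩, -⟩ := (LocalPrimitive.isCoveringMap_base hP).existsUnique_continuousMap_lifts
    (.id X) x₀ (⟨x₀, 0⟩ : LocalPrimitive P) rfl
  have hs' (x : X) : (s x).base = x := congrFun hs x
  refine ⟨fun x => (s x).value, fun x => ?_⟩
  obtain ⟨V, hV, hxV, hPV⟩ := hP x
  have hxx : P x x = 0 := by simpa using hPV x hxV x hxV
  have := ((LocalPrimitive.isOpen_sheet hV hPV (s x).value).preimage s.continuous).mem_nhds
    (x := x) (by simp [hs', hxx, hxV])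
  filter_upwards [this] with y hy
  simpa [hs'] using hy.2

/-- The Poincaré lemma for `1`-forms on a simply connected open set. -/
theorem IsOpen.exists_forall_hasFDerivAt_of_simplyConnectedSpace {E : Type*}
    [NormedAddCommGroup E] [NormedSpace ℝ E] {U : Set E} (hU : IsOpen U)
    [SimplyConnectedSpace U] {ω : E → E →L[ℝ] ℝ} (hω : DifferentiableOn ℝ ω U)
    (hdω : ∀ a ∈ U, ∀ x y, fderiv ℝ ω a x y = fderiv ℝ ω a y x) :
    ∃ φ : E → ℝ, ∀ a ∈ U, HasFDerivAt φ (ω a) a := by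
  have := hU.locallyPathConnectedSpace
  obtain ⟨φ, hφ⟩ := exists_eventually_eq_add_of_simplyConnectedSpace
    (X := U) (P := fun x y => ∫ᶜ z in .segment (x : E) y, ω z) fun x => by
      obtain ⟨r, hr, hrU⟩ := Metric.isOpen_iff.1 hU x x.2
      refine ⟨Metric.ball x r, Metric.isOpen_ball, Metric.mem_ball_self hr, fun y hy z hz => ?_⟩
      refine (convex_ball (x : E) r).curveIntegral_segment_add_eq_of_hasFDerivWithinAt_symmetric
        (fun a ha => ((hω a (hrU ha)).differentiableAt (hU.mem_nhds (hrU ha))).hasFDerivAt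
          |>.hasFDerivWithinAt)
        (fun a ha v _ w _ => hdω a (hrU ha) v w) (Metric.mem_ball_self hr) hy hz
  classical
  refine ⟨fun x => if hx : x ∈ U then φ ⟨x, hx⟩ else 0, fun a ha => ?_⟩
  have h : HasFDerivAt (fun x => φ ⟨a, ha⟩ + ∫ᶜ z in .segment a x, ω z) (ω a) a := by
    refine (HasFDerivAt.curveIntegral_segment_source' ?_).const_add _
    filter_upwards [hU.mem_nhds ha] with z hz
    exact (hω z hz).continuousWithinAt.continuousAt (hU.mem_nhds hz)
  refine h.congr_of_eventuallyEq ?_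
  have h' := hφ ⟨a, ha⟩
  rw [nhds_subtype_eq_comap, eventually_comap] at h'
  filter_upwards [hU.mem_nhds ha, h'] with x hx hx'
  simpa [hx] using hx' ⟨x, hx⟩ rfl

end Poincare

section PartialDerivatives

variable {n : ℕ} {U : Set (Fin n → ℝ)} {f g : (Fin n → ℝ) → ℝ} {u : Fin n → ℝ}

theorem contDiffOn_pd {k m : WithTop ℕ∞} (hf : ContDiffOn ℝ k f U) (hU : IsOpen U) (hm : m + 1 ≤ k)
    (i : Fin n) : ContDiffOn ℝ m (pd i f) U :=
  (hf.fderiv_of_isOpen hU hm).clm_apply contDiffOn_const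

theorem fderiv_apply_eq_sum_pd (f : (Fin n → ℝ) → ℝ) (u v : Fin n → ℝ) :
    fderiv ℝ f u v = ∑ i, v i * pd i f u := by
  conv_lhs => rw [← Finset.univ_sum_single v, map_sum]
  refine Finset.sum_congr rfl fun i _ => ?_
  rw [pd, ← smul_eq_mul, ← map_smul, ← Pi.single_smul, smul_eq_mul, mul_one]

theorem pd_congr (hU : IsOpen U) (hu : u ∈ U) (h : Set.EqOn f g U) (i : Fin n) :
    pd i f u = pd i g u := by
  rw [pd, pd, (h.eventuallyEq_of_mem (hU.mem_nhds hu)).fderiv_eq]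

theorem pd_comm (hU : IsOpen U) (hf : ContDiffOn ℝ 2 f U) (hu : u ∈ U) (i j : Fin n) :
    pd i (pd j f) u = pd j (pd i f) u := by
  have hd : DifferentiableAt ℝ (fderiv ℝ f) u :=
    ((hf.fderiv_of_isOpen hU (m := 1) (by norm_num)).differentiableOn one_ne_zero).differentiableAt
      (hU.mem_nhds hu)
  have h (i j : Fin n) :
      pd i (pd j f) u = fderiv ℝ (fderiv ℝ f) u (Pi.single i 1) (Pi.single j 1) := by
    change fderiv ℝ (fun x => fderiv ℝ f x (Pi.single j 1)) u (Pi.single i 1) = _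
    rw [fderiv_clm_apply hd (differentiableAt_const _)]
    simp
  rw [h, h]
  exact (hf.contDiffAt (hU.mem_nhds hu)).isSymmSndFDerivAt (by simp) _ _

theorem pd_fun_sum {ι : Type*} {s : Finset ι} {f : ι → (Fin n → ℝ) → ℝ}
    (hf : ∀ i ∈ s, DifferentiableAt ℝ (f i) u) (j : Fin n) :
    pd j (fun v => ∑ i ∈ s, f i v) u = ∑ i ∈ s, pd j (f i) u := by
  simp [pd, fderiv_fun_sum hf]

theorem pd_fun_mul (hf : DifferentiableAt ℝ f u) (hg : DifferentiableAt ℝ g u) (j : Fin n) :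
    pd j (fun v => f v * g v) u = pd j f u * g u + f u * pd j g u := by
  simp [pd, fderiv_fun_mul hf hg]
  ring

theorem pd_fun_mul_const (hf : DifferentiableAt ℝ f u) (c : ℝ) (j : Fin n) :
    pd j (fun v => f v * c) u = pd j f u * c := by
  rw [pd, pd, fderiv_mul_const hf]
  simp [mul_comm]

/-- On an open set the third partial derivatives of a `C³` function are symmetric under exchange
of the outer indices. -/
theorem pd_pd_pd_swap (hU : IsOpen U) (hf : ContDiffOn ℝ 3 f U) (hu : u ∈ U) (i j k : Fin n) :
    pd i (pd j (pd k f)) u = pd k (pd j (pd i f)) u := by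
  rw [pd_comm hU (contDiffOn_pd hf hU (by norm_num) k) hu,
    pd_congr hU hu fun v hv => pd_comm hU (hf.of_le (by norm_num)) hv i k,
    pd_comm hU (contDiffOn_pd hf hU (by norm_num) i) hu]

end PartialDerivatives

theorem sum_quadruple_eq_dotProduct {ι : Type*} [Fintype ι] (a b : ι → ℝ) (H C : Matrix ι ι ℝ) :
    ∑ α, ∑ μ, ∑ ν, ∑ β, a α * H α μ * C μ ν * H ν β * b β =
      Matrix.vecMul a (H * C * H) ⬝ᵥ b := by
  rw [← Matrix.vecMul_vecMul, ← Matrix.vecMul_vecMul]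
  simp only [Matrix.vecMul, dotProduct, Finset.sum_mul]
  rw [Finset.sum_congr rfl fun α _ => Finset.sum_comm_cycle, Finset.sum_comm]
  refine Finset.sum_congr rfl fun β _ => ?_
  rw [Finset.sum_comm_cycle]
  exact Finset.sum_congr rfl fun ν _ => Finset.sum_comm

/-- The Leibniz rule for the contraction of two vector fields with a matrix field. -/
theorem pd_sum_quadruple {n : ℕ} {a b : Fin n → (Fin n → ℝ) → ℝ}
    {C : Fin n → Fin n → (Fin n → ℝ) → ℝ} {u : Fin n → ℝ} (H : Matrix (Fin n) (Fin n) ℝ)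
    (ha : ∀ i, DifferentiableAt ℝ (a i) u) (hb : ∀ i, DifferentiableAt ℝ (b i) u)
    (hC : ∀ i j, DifferentiableAt ℝ (C i j) u) (ε : Fin n) :
    pd ε (fun v => ∑ α, ∑ μ, ∑ ν, ∑ β, a α v * H α μ * C μ ν v * H ν β * b β v) u =
      ∑ α, ∑ μ, ∑ ν, ∑ β, pd ε (a α) u * H α μ * C μ ν u * H ν β * b β u +
      ∑ α, ∑ μ, ∑ ν, ∑ β, a α u * H α μ * pd ε (C μ ν) u * H ν β * b β u +
      ∑ α, ∑ μ, ∑ ν, ∑ β, a α u * H α μ * C μ ν u * H ν β * pd ε (b β) u := by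
  rw [pd_fun_sum (by fun_prop)]
  simp only [← Finset.sum_add_distrib]
  refine Finset.sum_congr rfl fun α _ => ?_
  rw [pd_fun_sum (by fun_prop)]
  refine Finset.sum_congr rfl fun μ _ => ?_
  rw [pd_fun_sum (by fun_prop)]
  refine Finset.sum_congr rfl fun ν _ => ?_
  rw [pd_fun_sum (by fun_prop)]
  refine Finset.sum_congr rfl fun β _ => ?_
  rw [pd_fun_mul (by fun_prop) (by fun_prop), pd_fun_mul_const (by fun_prop),
    pd_fun_mul (by fun_prop) (by fun_prop), pd_fun_mul_const (by fun_prop)]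
  ring

/-- The contraction of the gradients of two solutions of the deformed flatness systems with the
structure constants of a solution of WDVV is a closed `1`-form. -/
theorem pd_eq_of_deformed_flatness {n : ℕ} {U : Set (Fin n → ℝ)} (hU : IsOpen U)
    {η : Matrix (Fin n) (Fin n) ℝ} (hsym : η.IsSymm)
    {F : (Fin n → ℝ) → ℝ} (hF : ContDiffOn ℝ 4 F U)
    (hWDVV : ∀ u ∈ U, ∀ α β ε ζ : Fin n,
      ∑ γ : Fin n, ∑ δ : Fin n,
        pd α (pd β (pd γ F)) u * η⁻¹ γ δ * pd δ (pd ε (pd ζ F)) u =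
      ∑ γ : Fin n, ∑ δ : Fin n,
        pd α (pd ε (pd γ F)) u * η⁻¹ γ δ * pd δ (pd β (pd ζ F)) u)
    {z₁ z₂ : ℝ} {f g : (Fin n → ℝ) → ℝ}
    (hf : ContDiffOn ℝ 3 f U) (hg : ContDiffOn ℝ 3 g U)
    (hfflat : ∀ u ∈ U, ∀ α β : Fin n,
      pd α (pd β f) u =
        z₁ * ∑ γ : Fin n, (∑ δ : Fin n, η⁻¹ γ δ * pd δ (pd α (pd β F)) u) * pd γ f u)
    (hgflat : ∀ u ∈ U, ∀ α β : Fin n,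
      pd α (pd β g) u =
        z₂ * ∑ γ : Fin n, (∑ δ : Fin n, η⁻¹ γ δ * pd δ (pd α (pd β F)) u) * pd γ g u)
    {u : Fin n → ℝ} (hu : u ∈ U) (δ ε : Fin n) :
    pd ε (fun u => ∑ α : Fin n, ∑ μ : Fin n, ∑ ν : Fin n, ∑ β : Fin n,
        pd α f u * η⁻¹ α μ * pd μ (pd δ (pd ν F)) u * η⁻¹ ν β * pd β g u) u =
    pd δ (fun u => ∑ α : Fin n, ∑ μ : Fin n, ∑ ν : Fin n, ∑ β : Fin n,
        pd α f u * η⁻¹ α μ * pd μ (pd ε (pd ν F)) u * η⁻¹ ν β * pd β g u) u := by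
  have hF3 : ContDiffOn ℝ 3 F U := hF.of_le (by norm_num)
  have hF₁ (i) := contDiffOn_pd hF hU (m := 3) (by norm_num) i
  have hF₂ (i j) := contDiffOn_pd (hF₁ j) hU (m := 2) (by norm_num) i
  have hd {h : (Fin n → ℝ) → ℝ} (hh : ContDiffOn ℝ 1 h U) : DifferentiableAt ℝ h u :=
    (hh.differentiableOn one_ne_zero).differentiableAt (hU.mem_nhds hu)
  have hf₁ (i) : DifferentiableAt ℝ (pd i f) u := hd (contDiffOn_pd hf hU (by norm_num) i)
  have hg₁ (i) : DifferentiableAt ℝ (pd i g) u := hd (contDiffOn_pd hg hU (by norm_num) i)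
  have hF₃ (i j k) : DifferentiableAt ℝ (pd i (pd j (pd k F))) u :=
    hd (contDiffOn_pd (hF₂ j k) hU (by norm_num) i)
  let H := η⁻¹
  let C (δ : Fin n) : Matrix (Fin n) (Fin n) ℝ := .of fun μ ν => pd μ (pd δ (pd ν F)) u
  let a (α : Fin n) : ℝ := pd α f u
  let b (α : Fin n) : ℝ := pd α g u
  have hH : H.transpose = H := hsym.inv
  have hCt (δ) : (C δ).transpose = C δ := by
    ext μ ν
    exact pd_pd_pd_swap hU hF3 hu ν δ μ
  have hCC : C δ * H * C ε = C ε * H * C δ := by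
    ext α ζ
    simp only [Matrix.mul_apply, Finset.sum_mul]
    exact Finset.sum_comm.trans ((hWDVV u hu α δ ε ζ).trans Finset.sum_comm)
  have hflat (z : ℝ) (h : (Fin n → ℝ) → ℝ) (hh : ∀ u ∈ U, ∀ α β : Fin n, pd α (pd β h) u =
        z * ∑ γ, (∑ δ, η⁻¹ γ δ * pd δ (pd α (pd β F)) u) * pd γ h u) (ε : Fin n) :
      (fun β => pd ε (pd β h) u) = z • Matrix.vecMul (fun γ => pd γ h u) (H * C ε) := by
    ext β
    simp [hh u hu, C, H, Matrix.vecMul, dotProduct, Matrix.mul_apply, mul_comm]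
  have hdC (μ ν) : pd ε (pd μ (pd δ (pd ν F))) u = pd δ (pd μ (pd ε (pd ν F))) u :=
    pd_pd_pd_swap hU (hF₁ ν) hu ε μ δ
  have hsum (δ ε : Fin n) :
      ∑ α, ∑ μ, ∑ ν, ∑ β, pd ε (pd α f) u * H α μ * C δ μ ν * H ν β * b β =
        z₁ * (Matrix.vecMul a (H * (C ε * H * C δ) * H) ⬝ᵥ b) := by
    rw [sum_quadruple_eq_dotProduct (fun α => pd ε (pd α f) u), hflat z₁ f hfflat]
    simp only [Matrix.smul_vecMul, smul_dotProduct, Matrix.vecMul_vecMul, smul_eq_mul,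
      Matrix.mul_assoc]
    rfl
  have hsum' (δ ε : Fin n) :
      ∑ α, ∑ μ, ∑ ν, ∑ β, a α * H α μ * C δ μ ν * H ν β * pd ε (pd β g) u =
        z₂ * (Matrix.vecMul a (H * (C δ * H * C ε) * H) ⬝ᵥ b) := by
    rw [sum_quadruple_eq_dotProduct a (fun α => pd ε (pd α g) u), hflat z₂ g hgflat,
      ← Matrix.mulVec_transpose (H * C ε)]
    simp only [Matrix.transpose_mul, hCt, hH, dotProduct_smul, smul_eq_mul,
      Matrix.dotProduct_mulVec, Matrix.vecMul_vecMul, Matrix.mul_assoc]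
    rfl
  rw [pd_sum_quadruple η⁻¹ hf₁ hg₁ (fun μ ν => hF₃ μ δ ν),
    pd_sum_quadruple η⁻¹ hf₁ hg₁ (fun μ ν => hF₃ μ ε ν)]
  congr 1
  · congr 1
    · refine (hsum δ ε).trans (Eq.trans ?_ (hsum ε δ).symm)
      rw [hCC]
    · simp only [hdC]
  · refine (hsum' δ ε).trans (Eq.trans ?_ (hsum' ε δ).symm)
    rw [hCC]

theorem principal_hierarchy_involutivity (n : ℕ) (U : Set (Fin n → ℝ)) (hU : IsOpen U)
    (hsc : SimplyConnectedSpace U)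
    (η : Matrix (Fin n) (Fin n) ℝ) (hsym : η.IsSymm) (hinv : IsUnit η)
    (F : (Fin n → ℝ) → ℝ) (hF : ContDiffOn ℝ 4 F U)
    (hWDVV : ∀ u ∈ U, ∀ α β ε ζ : Fin n,
      ∑ γ : Fin n, ∑ δ : Fin n,
        pd α (pd β (pd γ F)) u * η⁻¹ γ δ * pd δ (pd ε (pd ζ F)) u =
      ∑ γ : Fin n, ∑ δ : Fin n,
        pd α (pd ε (pd γ F)) u * η⁻¹ γ δ * pd δ (pd β (pd ζ F)) u)
    (z₁ z₂ : ℝ) (f g : (Fin n → ℝ) → ℝ)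
    (hf : ContDiffOn ℝ 3 f U) (hg : ContDiffOn ℝ 3 g U)
    (hfflat : ∀ u ∈ U, ∀ α β : Fin n,
      pd α (pd β f) u =
        z₁ * ∑ γ : Fin n, (∑ δ : Fin n, η⁻¹ γ δ * pd δ (pd α (pd β F)) u) * pd γ f u)
    (hgflat : ∀ u ∈ U, ∀ α β : Fin n,
      pd α (pd β g) u =
        z₂ * ∑ γ : Fin n, (∑ δ : Fin n, η⁻¹ γ δ * pd δ (pd α (pd β F)) u) * pd γ g u)
    (T : Fin n → (Fin n → ℝ) → ℝ)
    (hT : ∀ (δ : Fin n) (u : Fin n → ℝ), T δ u =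
      ∑ α : Fin n, ∑ μ : Fin n, ∑ ν : Fin n, ∑ β : Fin n,
        pd α f u * η⁻¹ α μ * pd μ (pd δ (pd ν F)) u * η⁻¹ ν β * pd β g u) :
    (∀ u ∈ U, ∀ δ ε : Fin n, pd ε (T δ) u = pd δ (T ε) u) ∧
    (∀ u : ℝ → (Fin n → ℝ), ContDiff ℝ (⊤ : ℕ∞) u → Function.Periodic u 1 → (∀ x : ℝ, u x ∈ U) →
      ∫ x in (0:ℝ)..1,
        ∑ α : Fin n, ∑ β : Fin n,
          pd α f (u x) * η⁻¹ α β * deriv (fun s => pd β g (u s)) x = 0) := by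
  have hclosed : ∀ u ∈ U, ∀ δ ε : Fin n, pd ε (T δ) u = pd δ (T ε) u := by
    intro u hu δ ε
    rw [funext (hT δ), funext (hT ε)]
    exact pd_eq_of_deformed_flatness hU hsym hF hWDVV hf hg hfflat hgflat hu δ ε
  refine ⟨hclosed, fun u hu hper huU => ?_⟩
  have hTd (δ) : DifferentiableOn ℝ (T δ) U := by
    have hf₁ (i) : DifferentiableOn ℝ (pd i f) U :=
      (contDiffOn_pd hf hU (m := 1) (by norm_num) i).differentiableOn one_ne_zero
    have hg₁ (i) : DifferentiableOn ℝ (pd i g) U :=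
      (contDiffOn_pd hg hU (m := 1) (by norm_num) i).differentiableOn one_ne_zero
    have hF₃ (i j k) : DifferentiableOn ℝ (pd i (pd j (pd k F))) U :=
      (contDiffOn_pd (contDiffOn_pd (contDiffOn_pd hF hU (m := 3) (by norm_num) k) hU (m := 2)
        (by norm_num) j) hU (m := 1) (by norm_num) i).differentiableOn one_ne_zero
    rw [funext (hT δ)]
    fun_prop
  let ω (v : Fin n → ℝ) : (Fin n → ℝ) →L[ℝ] ℝ :=
    ∑ δ, T δ v • ContinuousLinearMap.proj (R := ℝ) (φ := fun _ : Fin n => ℝ) δ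
  have hω : DifferentiableOn ℝ ω U := by fun_prop
  have hdω (v) (hv : v ∈ U) (x y) : fderiv ℝ ω v x y = fderiv ℝ ω v y x := by
    have hTv (δ) : DifferentiableAt ℝ (T δ) v := (hTd δ).differentiableAt (hU.mem_nhds hv)
    have h (x y) : fderiv ℝ ω v x y = ∑ δ, ∑ ε, x ε * pd ε (T δ) v * y δ := by
      have hωv : HasFDerivAt (fun w => ω w y) (∑ δ, y δ • fderiv ℝ (T δ) v) v := by
        simp only [ω, sum_apply, smul_apply, ContinuousLinearMap.proj_apply, smul_eq_mul]
        exact HasFDerivAt.fun_sum fun δ _ => (hTv δ).hasFDerivAt.mul_const (y δ)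
      have hωv' : HasFDerivAt (fun w => ω w y) ((fderiv ℝ ω v).flip y) v :=
        ((hω.differentiableAt (hU.mem_nhds hv)).hasFDerivAt.clm_apply
          (hasFDerivAt_const y v)).congr_fderiv (by ext; simp)
      have hxy := DFunLike.congr_fun (hωv'.unique hωv) x
      rw [ContinuousLinearMap.flip_apply] at hxy
      rw [hxy]
      simp only [sum_apply, smul_apply, smul_eq_mul, fderiv_apply_eq_sum_pd, Finset.mul_sum]
      exact Finset.sum_congr rfl fun δ _ => Finset.sum_congr rfl fun ε _ => mul_comm _ _
    rw [h, h, Finset.sum_comm]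
    refine Finset.sum_congr rfl fun ε _ => Finset.sum_congr rfl fun δ _ => ?_
    rw [hclosed v hv]
    ring
  obtain ⟨φ, hφ⟩ := hU.exists_forall_hasFDerivAt_of_simplyConnectedSpace hω hdω
  have hud : Differentiable ℝ u := hu.differentiable (by simp)
  have hint (x : ℝ) : ∑ α : Fin n, ∑ β : Fin n,
      pd α f (u x) * η⁻¹ α β * deriv (fun s => pd β g (u s)) x = z₂ * ω (u x) (deriv u x) := by
    have hgd (β) : deriv (fun s => pd β g (u s)) x =
        ∑ ε, deriv u x ε * pd ε (pd β g) (u x) := by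
      rw [← fderiv_apply_eq_sum_pd]
      have hgβ : DifferentiableAt ℝ (pd β g) (u x) :=
        ((contDiffOn_pd hg hU (m := 1) (by norm_num) β).differentiableOn
          one_ne_zero).differentiableAt (hU.mem_nhds (huU x))
      exact (hgβ.hasFDerivAt.comp_hasDerivAt x (hud x).hasDerivAt).deriv
    have hTz (ε) : ∑ α, ∑ β, pd α f (u x) * η⁻¹ α β * pd ε (pd β g) (u x) = z₂ * T ε (u x) := by
      rw [hT, Finset.mul_sum]
      refine Finset.sum_congr rfl fun α _ => ?_
      rw [Finset.mul_sum]
      refine Finset.sum_congr rfl fun β _ => ?_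
      simp only [hgflat (u x) (huU x), Finset.sum_mul, Finset.mul_sum]
      rw [Finset.sum_comm]
      refine Finset.sum_congr rfl fun δ _ => Finset.sum_congr rfl fun γ _ => ?_
      rw [pd_pd_pd_swap hU (hF.of_le (by norm_num)) (huU x) δ ε β, hsym.inv.apply γ δ]
      ring
    simp only [hgd, ω, sum_apply, smul_apply,
      ContinuousLinearMap.proj_apply, smul_eq_mul, Finset.mul_sum, ← mul_assoc, ← hTz,
      Finset.sum_mul]
    rw [Finset.sum_comm_cycle]
    refine Finset.sum_congr rfl fun ε _ => Finset.sum_congr rfl fun α _ =>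
      Finset.sum_congr rfl fun β _ => ?_
    ring
  have hcont : Continuous fun x => z₂ * ω (u x) (deriv u x) := by
    have h₁ : Continuous fun x => ω (u x) :=
      hω.continuousOn.comp_continuous hu.continuous huU
    exact continuous_const.mul (h₁.clm_apply (hu.continuous_deriv (by simp)))
  have hderiv (x : ℝ) : HasDerivAt (fun s => z₂ * φ (u s)) (z₂ * ω (u x) (deriv u x)) x :=
    ((hφ (u x) (huU x)).comp_hasDerivAt x (hud x).hasDerivAt).const_mul z₂
  simp only [hint]
  rw [intervalIntegral.integral_eq_sub_of_hasDerivAt (fun x _ => hderiv x)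
    (hcont.intervalIntegrable 0 1)]
  have h01 : u 1 = u 0 := by simpa using hper 0
  rw [h01, sub_self]
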